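/- arXiv:2408.15728 — 3 statements merged into one kernel-verified Lean document; each statement's English description precedes it below -/
import Mathlib

section
/- Let F be an infinite field, let I, J, K, I', J', K' be finite sets, let Φ ⊆ I × J × K, and let f : I → I', g : J → J', h : K → K' be arbitrary functions. Then R_s(Φ) ≥ R_s((f × g × h)(Φ)), where (f × g × h)(Φ) = {(f(i), g(j), h(k)) : (i,j,k) ∈ Φ} ⊆ I' × J' × K'. -/
open scoped BigOperators

/-- The rank of a tensor `t : I × J × K → F`: the least `L` such that `t` is a sum of `L`
simple tensors. -/
noncomputable def TensorRank (F : Type*) [Field F] {I J K : Type*} (t : I × J × K → F) : ℕ :=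
  sInf {L : ℕ | ∃ (a : Fin L → I → F) (b : Fin L → J → F) (c : Fin L → K → F),
    ∀ q : I × J × K, t q = ∑ m, a m q.1 * b m q.2.1 * c m q.2.2}

/-- The support rank of `Φ ⊆ I × J × K`: the minimum rank of a tensor with support `Φ`. -/
noncomputable def SupportRank (F : Type*) [Field F] {I J K : Type*} (Φ : Set (I × J × K)) : ℕ :=
  sInf (TensorRank F '' {t : I × J × K → F | {q | t q ≠ 0} = Φ})

/-- Every tensor with finite index sets attains its rank. -/
lemma exists_tensorRank_decomposition {F : Type*} [Field F] {I J K : Type*} [Finite I] [Finite J]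
    [Finite K] (t : I × J × K → F) :
    ∃ (a : Fin (TensorRank F t) → I → F) (b : Fin (TensorRank F t) → J → F)
      (c : Fin (TensorRank F t) → K → F),
      ∀ q : I × J × K, t q = ∑ m, a m q.1 * b m q.2.1 * c m q.2.2 := by
  classical
  have hne : {L : ℕ | ∃ (a : Fin L → I → F) (b : Fin L → J → F) (c : Fin L → K → F),
      ∀ q : I × J × K, t q = ∑ m, a m q.1 * b m q.2.1 * c m q.2.2}.Nonempty := by
    obtain ⟨L, ⟨e⟩⟩ := Finite.exists_equiv_fin (I × J × K)
    refine ⟨L, fun m i => if (e.symm m).1 = i then t (e.symm m) else 0,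
      fun m j => if (e.symm m).2.1 = j then 1 else 0,
      fun m k => if (e.symm m).2.2 = k then 1 else 0, fun q => ?_⟩
    rw [Finset.sum_eq_single (e q)]
    · simp
    · intro m _ hm
      have hq : e.symm m ≠ q := fun h => hm (by simp [← h])
      by_contra hprod
      simp only [mul_eq_zero, not_or, ite_eq_right_iff, Classical.not_imp] at hprod
      exact hq (Prod.ext hprod.1.1.1 (Prod.ext hprod.1.2.1 hprod.2.1))
    · simp
  exact Nat.sInf_mem hne

/-- Contracting a tensor with matrices in the three directions does not increase its rank. -/
lemma tensorRank_contract_le {F : Type*} [Field F] {I J K I' J' K' : Type*} [Fintype I]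
    [Fintype J] [Fintype K] (t : I × J × K → F) (P : I' → I → F) (Q : J' → J → F)
    (R : K' → K → F) :
    TensorRank F (fun q : I' × J' × K' =>
      ∑ i, P q.1 i * ∑ j, Q q.2.1 j * ∑ k, R q.2.2 k * t (i, j, k)) ≤ TensorRank F t := by
  obtain ⟨a, b, c, habc⟩ := exists_tensorRank_decomposition t
  refine Nat.sInf_le ⟨fun m i' => ∑ i, P i' i * a m i, fun m j' => ∑ j, Q j' j * b m j,
    fun m k' => ∑ k, R k' k * c m k, fun q => ?_⟩
  have hk (i : I) (j : J) : ∑ k, R q.2.2 k * t (i, j, k) =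
      ∑ m, a m i * b m j * ∑ k, R q.2.2 k * c m k := by
    simp only [habc, Finset.mul_sum]
    rw [Finset.sum_comm]
    exact Finset.sum_congr rfl fun m _ => Finset.sum_congr rfl fun k _ => by ring
  have hj (i : I) : ∑ j, Q q.2.1 j * ∑ k, R q.2.2 k * t (i, j, k) =
      ∑ m, a m i * (∑ j, Q q.2.1 j * b m j) * ∑ k, R q.2.2 k * c m k := by
    simp only [hk]
    simp_rw [Finset.mul_sum (s := Finset.univ (α := Fin _))]
    rw [Finset.sum_comm]
    refine Finset.sum_congr rfl fun m _ => ?_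
    rw [Finset.mul_sum (s := Finset.univ (α := J)), Finset.sum_mul]
    exact Finset.sum_congr rfl fun j _ => by ring
  simp only [hj]
  simp_rw [Finset.mul_sum (s := Finset.univ (α := Fin _))]
  rw [Finset.sum_comm]
  refine Finset.sum_congr rfl fun m _ => ?_
  rw [Finset.sum_mul, Finset.sum_mul]
  exact Finset.sum_congr rfl fun i _ => by ring

/-- Over an infinite field, finitely many vectors can be pushed forward along a map of their index
sets, with generic weights, such that the supports are mapped without cancellation. -/
lemma exists_matrix_sum_ne_zero_iff {F : Type*} [Field F] [Infinite F] {I I' X : Type*}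
    [Fintype I] [Finite I'] [Finite X] (f : I → I') (s : I → X → F) :
    ∃ P : I' → I → F, ∀ i' x, ∑ i, P i' i * s i x ≠ 0 ↔ ∃ i, f i = i' ∧ s i x ≠ 0 := by
  classical
  let v : I' × X → I → F := fun y i => if f i = y.1 then s i y.2 else 0
  obtain ⟨φ, hφ⟩ := Module.exists_dual_forall_apply_ne_zero (K := F)
    (fun y : {y // v y ≠ 0} => v y) fun y => y.2
  refine ⟨fun i' i => if f i = i' then φ (Pi.single i 1) else 0, fun i' x => ?_⟩
  have hsum : ∑ i, (if f i = i' then φ (Pi.single i 1) else 0) * s i x = φ (v (i', x)) := by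
    rw [LinearMap.pi_apply_eq_sum_univ φ (v (i', x))]
    refine Finset.sum_congr rfl fun i _ => ?_
    have hsingle : (fun j => if i = j then (1 : F) else 0) = Pi.single i 1 := by
      ext j
      simp [Pi.single_apply, eq_comm]
    by_cases hi : f i = i' <;> simp [v, hi, hsingle, mul_comm]
  have hv : v (i', x) ≠ 0 ↔ ∃ i, f i = i' ∧ s i x ≠ 0 := by
    simp [v, Function.ne_iff]
  rw [hsum, ← hv]
  exact ⟨fun h h0 => h (by simp [h0]), fun h => hφ ⟨_, h⟩⟩

theorem supportRank_image_le (F : Type*) [Field F] [Infinite F]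
    {I J K I' J' K' : Type*} [Fintype I] [Fintype J] [Fintype K]
    [Fintype I'] [Fintype J'] [Fintype K']
    (Φ : Set (I × J × K)) (f : I → I') (g : J → J') (h : K → K') :
    SupportRank F ((fun q : I × J × K => (f q.1, g q.2.1, h q.2.2)) '' Φ) ≤
      SupportRank F Φ := by
  classical
  have hne : (TensorRank F '' {t : I × J × K → F | {q | t q ≠ 0} = Φ}).Nonempty :=
    ⟨_, Φ.indicator 1, by ext q; simp, rfl⟩
  obtain ⟨t, ht, hrank⟩ := Nat.sInf_mem hne
  have hsupp : {q | t q ≠ 0} = Φ := ht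
  obtain ⟨R, hR⟩ := exists_matrix_sum_ne_zero_iff h fun k (x : I × J) => t (x.1, x.2, k)
  obtain ⟨Q, hQ⟩ := exists_matrix_sum_ne_zero_iff g fun j (x : I × K') =>
    ∑ k, R x.2 k * t (x.1, j, k)
  obtain ⟨P, hP⟩ := exists_matrix_sum_ne_zero_iff f fun i (x : J' × K') =>
    ∑ j, Q x.1 j * ∑ k, R x.2 k * t (i, j, k)
  refine le_trans (Nat.sInf_le ⟨_, ?_, rfl⟩) ((tensorRank_contract_le t P Q R).trans hrank.le)
  ext ⟨i', j', k'⟩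
  have hi := hP i' (j', k')
  have hj (i : I) := hQ j' (i, k')
  have hk (i : I) (j : J) := hR k' (i, j)
  simp only at hi hj hk
  simp only [Set.mem_ofPred_eq, hi, hj, hk, ← hsupp, Set.mem_image, Prod.exists, Prod.mk.injEq]
  constructor
  · rintro ⟨i, hfi, j, hgj, k, hhk, htq⟩
    exact ⟨i, j, k, htq, hfi, hgj, hhk⟩
  · rintro ⟨i, j, k, htq, hfi, hgj, hhk⟩
    exact ⟨i, hfi, j, hgj, k, hhk, htq⟩
end

section
/- Let F be an infinite field, let I, J, K, I', J', K' be finite sets, Λ ⊆ I × J × K, and f : I → I', g : J → J', h : K → K' arbitrary functions. Then R_s(Φ(Λ)) ≥ R_s(Φ((f × g × h)(Λ))). -/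
open scoped BigOperators

/-- The support of the partial matrix multiplication tensor with pattern `Λ ⊆ I × J × K`. -/
def PMMSupport {I J K : Type*} (Λ : Set (I × J × K)) :
    Set ((I × J) × (J × K) × (K × I)) :=
  {q | ∃ i j k, (i, j, k) ∈ Λ ∧ q = ((i, j), (j, k), (k, i))}

/-- Applying linear maps to the three legs of a tensor does not increase its rank. -/
lemma tensorRank_restriction_le {F : Type*} [Field F] {I J K I' J' K' : Type*}
    [Fintype I] [Fintype J] [Fintype K] (t : I × J × K → F)
    (A : I' → I → F) (B : J' → J → F) (C : K' → K → F) :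
    TensorRank F (fun p : I' × J' × K' =>
      ∑ q : I × J × K, A p.1 q.1 * B p.2.1 q.2.1 * C p.2.2 q.2.2 * t q) ≤ TensorRank F t := by
  obtain ⟨a, b, c, habc⟩ := exists_tensorRank_decomposition t
  refine Nat.sInf_le ⟨fun m i => ∑ u, A i u * a m u, fun m j => ∑ v, B j v * b m v,
    fun m k => ∑ w, C k w * c m w, fun p => ?_⟩
  simp_rw [habc, Finset.mul_sum (Finset.univ : Finset (Fin (TensorRank F t)))]
  rw [Finset.sum_comm]
  refine Finset.sum_congr rfl fun m _ => ?_
  rw [mul_assoc (∑ u, A p.1 u * a m u), Fintype.sum_mul_sum, ← Fintype.sum_prod_type',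
    Fintype.sum_mul_sum, ← Fintype.sum_prod_type']
  exact Finset.sum_congr rfl fun q _ => by ring

lemma supportRank_le_tensorRank {F : Type*} [Field F] {I J K : Type*} {Φ : Set (I × J × K)}
    {t : I × J × K → F} (ht : {q | t q ≠ 0} = Φ) : SupportRank F Φ ≤ TensorRank F t :=
  Nat.sInf_le ⟨t, ht, rfl⟩

lemma exists_tensorRank_eq_supportRank (F : Type*) [Field F] {I J K : Type*}
    (Φ : Set (I × J × K)) :
    ∃ t : I × J × K → F, {q | t q ≠ 0} = Φ ∧ TensorRank F t = SupportRank F Φ := by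
  classical
  refine Nat.sInf_mem (s := TensorRank F '' {t : I × J × K → F | {q | t q ≠ 0} = Φ})
    (Set.Nonempty.image _ ⟨fun q => if q ∈ Φ then 1 else 0, ?_⟩)
  ext q
  simp

/-- Finitely many polynomials over an infinite field, none of them vanishing identically, have a
common point of non-vanishing. -/
lemma MvPolynomial.exists_forall_eval_ne_zero {F σ ι : Type*} [Field F] [Infinite F] [Finite ι]
    (P : ι → MvPolynomial σ F) (hP : ∀ i, ∃ x, eval x (P i) ≠ 0) :
    ∃ x, ∀ i, eval x (P i) ≠ 0 := by
  have := Fintype.ofFinite ι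
  have hprod : ∏ i, P i ≠ 0 := Finset.prod_ne_zero_iff.2 fun i _ h0 => by
    obtain ⟨x, hx⟩ := hP i
    simp [h0] at hx
  by_contra! hx
  refine hprod (MvPolynomial.funext fun x => ?_)
  obtain ⟨i, hi⟩ := hx x
  rw [map_prod, map_zero]
  exact Finset.prod_eq_zero (Finset.mem_univ i) hi

/-- Vectors on the three index sets can be chosen so that a trilinear weighting of `l` has
nonzero sum over every fibre of a map `φ` that meets the support of `l`. -/
lemma exists_weights_fiber_sum_ne_zero {F : Type*} [Field F] [Infinite F] {I J K M : Type*}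
    [Fintype I] [Fintype J] [Fintype K] [DecidableEq M] (l : I × J × K → F)
    (φ : I × J × K → M) :
    ∃ (x : I → F) (y : J → F) (z : K → F), ∀ s, l s ≠ 0 →
      ∑ r, (if φ r = φ s then x r.1 * y r.2.1 * z r.2.2 * l r else 0) ≠ 0 := by
  classical
  let P : {s // l s ≠ 0} → MvPolynomial (I ⊕ J ⊕ K) F := fun s =>
    ∑ r, if φ r = φ s then MvPolynomial.X (.inl r.1) * MvPolynomial.X (.inr (.inl r.2.1)) *
      MvPolynomial.X (.inr (.inr r.2.2)) * MvPolynomial.C (l r) else 0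
  have heval (w : I ⊕ J ⊕ K → F) (s) : MvPolynomial.eval w (P s) = ∑ r, if φ r = φ s then
      w (.inl r.1) * w (.inr (.inl r.2.1)) * w (.inr (.inr r.2.2)) * l r else 0 := by
    simp only [P, map_sum, apply_ite (MvPolynomial.eval w), map_mul, MvPolynomial.eval_X,
      MvPolynomial.eval_C, map_zero]
  obtain ⟨w, hw⟩ := MvPolynomial.exists_forall_eval_ne_zero P fun s => by
    refine ⟨Sum.elim (Pi.single s.1.1 1) (Sum.elim (Pi.single s.1.2.1 1)
      (Pi.single s.1.2.2 1)), ?_⟩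
    rw [heval, Fintype.sum_eq_single s.1]
    · simpa using s.2
    · rintro ⟨i, j, k⟩ hne
      simp only [Sum.elim_inl, Sum.elim_inr, Pi.single_apply]
      split_ifs with _ h₁ h₂ h₃ <;> simp
      exact absurd (Prod.ext h₁ (Prod.ext h₂ h₃)) hne
  refine ⟨fun i => w (.inl i), fun j => w (.inr (.inl j)), fun k => w (.inr (.inr k)),
    fun s hs => ?_⟩
  rw [← heval w ⟨s, hs⟩]
  exact hw ⟨s, hs⟩

theorem supportRank_pmm_image_le (F : Type*) [Field F] [Infinite F]
    {I J K I' J' K' : Type*} [Fintype I] [Fintype J] [Fintype K]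
    [Fintype I'] [Fintype J'] [Fintype K']
    (Λ : Set (I × J × K)) (f : I → I') (g : J → J') (h : K → K') :
    SupportRank F (PMMSupport ((fun q : I × J × K => (f q.1, g q.2.1, h q.2.2)) '' Λ)) ≤
      SupportRank F (PMMSupport Λ) := by
  classical
  obtain ⟨t, ht, hrank⟩ := exists_tensorRank_eq_supportRank F (PMMSupport Λ)
  rw [← hrank]
  let e : I × J × K → (I × J) × (J × K) × (K × I) :=
    fun s => ((s.1, s.2.1), (s.2.1, s.2.2), (s.2.2, s.1))
  have he : Function.Injective e := by
    rintro ⟨i, j, k⟩ ⟨i', j', k'⟩ hs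
    simp only [e, Prod.mk.injEq] at hs ⊢
    tauto
  have hsupp (q) : t q ≠ 0 ↔ q ∈ PMMSupport Λ := Set.ext_iff.1 ht q
  have hmem (s) : t (e s) ≠ 0 ↔ s ∈ Λ := by
    rw [hsupp]
    constructor
    · rintro ⟨i, j, k, hΛ, hs⟩
      rwa [he (a₂ := (i, j, k)) hs]
    · exact fun hs => ⟨s.1, s.2.1, s.2.2, hs, rfl⟩
  obtain ⟨x, y, z, hxyz⟩ := exists_weights_fiber_sum_ne_zero (fun s => t (e s))
    (fun s => (f s.1, g s.2.1, h s.2.2))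
  let A : I' × J' → I × J → F := fun p u => if f u.1 = p.1 ∧ g u.2 = p.2 then x u.1 else 0
  let B : J' × K' → J × K → F := fun p u => if g u.1 = p.1 ∧ h u.2 = p.2 then y u.1 else 0
  let C : K' × I' → K × I → F := fun p u => if h u.1 = p.1 ∧ f u.2 = p.2 then z u.1 else 0
  refine (supportRank_le_tensorRank ?_).trans (tensorRank_restriction_le t A B C)
  ext p
  have hsum : ∑ q, A p.1 q.1 * B p.2.1 q.2.1 * C p.2.2 q.2.2 * t q =
      ∑ s, A p.1 (e s).1 * B p.2.1 (e s).2.1 * C p.2.2 (e s).2.2 * t (e s) := by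
    refine (Fintype.sum_of_injective e he _ _ (fun q hq => ?_) fun _ => rfl).symm
    by_contra hne
    obtain ⟨i, j, k, -, rfl⟩ := (hsupp q).1 (right_ne_zero_of_mul hne)
    exact hq ⟨(i, j, k), rfl⟩
  rw [Set.mem_ofPred_eq, hsum]
  constructor
  · intro hne
    obtain ⟨s, -, hs⟩ := Finset.exists_ne_zero_of_sum_ne_zero hne
    have hΛ := (hmem s).1 (right_ne_zero_of_mul hs)
    refine ⟨f s.1, g s.2.1, h s.2.2, ⟨s, hΛ, rfl⟩, ?_⟩
    obtain ⟨⟨p₁, p₂⟩, ⟨p₃, p₄⟩, p₅, p₆⟩ := p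
    simp only [A, B, C, e, ne_eq, mul_eq_zero, ite_eq_right_iff, not_or, Classical.not_imp] at hs
    simp only [Prod.mk.injEq]
    grind
  · rintro ⟨_, _, _, ⟨s, hs, hs'⟩, rfl⟩
    cases hs'
    convert hxyz s ((hmem s).2 hs) using 2 with r
    simp only [A, B, C, e, Prod.mk.injEq]
    split_ifs <;> first | rfl | tauto | simp
end

section
/- Let P be a probability distribution on I × J × K, where I, J, K are finite sets. Then the set {(a,b,c) ∈ ℝ≥0³ : a ≤ H(I)_P, b ≤ H(J)_P, c ≤ H(K)_P, a+b ≤ H(IJ)_P, a+c ≤ H(IK)_P, b+c ≤ H(JK)_P, a+b+c ≤ H(IJK)_P} equals the set of all (a,b,c) ∈ ℝ≥0³ that are coordinatewise dominated by some convex combination of the six points (H(I)_P, H(J|I)_P, H(K|IJ)_P), (H(I)_P, H(J|IK)_P, H(K|I)_P), (H(I|J)_P, H(J)_P, H(K|IJ)_P), (H(I|JK)_P, H(J)_P, H(K|J)_P), (H(I|K)_P, H(J|IK)_P, H(K)_P), (H(I|JK)_P, H(J|K)_P, H(K)_P). -/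
open scoped BigOperators

/-- `P` is a probability distribution on the finite set `X`. -/
def IsProbDist {X : Type*} [Fintype X] (P : X → ℝ) : Prop :=
  (∀ x, 0 ≤ P x) ∧ ∑ x, P x = 1

/-- Shannon entropy (in bits) of a distribution on a finite set. -/
noncomputable def entropy {X : Type*} [Fintype X] (P : X → ℝ) : ℝ :=
  -∑ x, P x * Real.logb 2 (P x)

noncomputable def margI {I J K : Type*} [Fintype J] [Fintype K]
    (P : I × J × K → ℝ) : I → ℝ := fun i => ∑ j, ∑ k, P (i, j, k)

noncomputable def margJ {I J K : Type*} [Fintype I] [Fintype K]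
    (P : I × J × K → ℝ) : J → ℝ := fun j => ∑ i, ∑ k, P (i, j, k)

noncomputable def margK {I J K : Type*} [Fintype I] [Fintype J]
    (P : I × J × K → ℝ) : K → ℝ := fun k => ∑ i, ∑ j, P (i, j, k)

noncomputable def margIJ {I J K : Type*} [Fintype K]
    (P : I × J × K → ℝ) : I × J → ℝ := fun p => ∑ k, P (p.1, p.2, k)

noncomputable def margIK {I J K : Type*} [Fintype J]
    (P : I × J × K → ℝ) : I × K → ℝ := fun p => ∑ j, P (p.1, j, p.2)

noncomputable def margJK {I J K : Type*} [Fintype I]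
    (P : I × J × K → ℝ) : J × K → ℝ := fun p => ∑ i, P (i, p.1, p.2)

/-- The six vertex rate triples
`(H(I), H(J|I), H(K|IJ))`, `(H(I), H(J|IK), H(K|I))`, `(H(I|J), H(J), H(K|IJ))`,
`(H(I|JK), H(J), H(K|J))`, `(H(I|K), H(J|IK), H(K))`, `(H(I|JK), H(J|K), H(K))`,
where conditional entropies are defined by the chain rule. -/
noncomputable def entropyVertices {I J K : Type*} [Fintype I] [Fintype J] [Fintype K]
    (P : I × J × K → ℝ) : Fin 6 → ℝ × ℝ × ℝ :=
  ![(entropy (margI P), entropy (margIJ P) - entropy (margI P),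
      entropy P - entropy (margIJ P)),
    (entropy (margI P), entropy P - entropy (margIK P),
      entropy (margIK P) - entropy (margI P)),
    (entropy (margIJ P) - entropy (margJ P), entropy (margJ P),
      entropy P - entropy (margIJ P)),
    (entropy P - entropy (margJK P), entropy (margJ P),
      entropy (margJK P) - entropy (margJ P)),
    (entropy (margIK P) - entropy (margK P), entropy P - entropy (margIK P),
      entropy (margK P)),
    (entropy P - entropy (margJK P), entropy (margJK P) - entropy (margK P),
      entropy (margK P))]

/-- Summing `x log x` over the atoms of a finite family is at most `x log x` at the total mass. -/
theorem sum_mul_logb_le {C : Type*} [Fintype C] (q : C → ℝ) (hq : ∀ c, 0 ≤ q c) :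
    ∑ c, q c * Real.logb 2 (q c) ≤ (∑ c, q c) * Real.logb 2 (∑ c, q c) := by
  rw [Finset.sum_mul]
  refine Finset.sum_le_sum fun c _ => ?_
  rcases (hq c).eq_or_lt with h | h
  · simp [← h]
  · exact mul_le_mul_of_nonneg_left (Real.logb_le_logb_of_le one_lt_two h
      (Finset.single_le_sum (fun c _ => hq c) (Finset.mem_univ c))) h.le

/-- Pointwise form of the Gibbs inequality. -/
theorem mul_log_add_sub_le {x y z t : ℝ} (hx : 0 ≤ x) (hy : x ≤ y) (hz : x ≤ z) (ht : x ≤ t) :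
    x * (Real.log y + Real.log z - Real.log x - Real.log t) ≤ y * z / t - x := by
  rcases hx.eq_or_lt with rfl | hx
  · simpa using div_nonneg (mul_nonneg hy hz) ht
  · have hy' := hx.trans_le hy
    have hz' := hx.trans_le hz
    have ht' := hx.trans_le ht
    have key : Real.log (y * z / (x * t)) = Real.log y + Real.log z - Real.log x - Real.log t := by
      rw [Real.log_div (by positivity) (by positivity), Real.log_mul hy'.ne' hz'.ne',
        Real.log_mul hx.ne' ht'.ne']
      ring
    rw [← key]
    calc x * Real.log (y * z / (x * t)) ≤ x * (y * z / (x * t) - 1) :=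
          mul_le_mul_of_nonneg_left (Real.log_le_sub_one_of_pos (by positivity)) hx.le
      _ = y * z / t - x := by field_simp

/-- Nonnegativity of mutual information for an unnormalised nonnegative matrix, natural logarithm. -/
theorem sum_mul_log_marginals_le {B C : Type*} [Fintype B] [Fintype C] (q : B → C → ℝ)
    (hq : ∀ b c, 0 ≤ q b c) :
    ∑ b, (∑ c, q b c) * Real.log (∑ c, q b c) + ∑ c, (∑ b, q b c) * Real.log (∑ b, q b c) ≤
      ∑ b, ∑ c, q b c * Real.log (q b c) +
        (∑ b, ∑ c, q b c) * Real.log (∑ b, ∑ c, q b c) := by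
  set t := ∑ b, ∑ c, q b c with ht
  have hrow : ∀ b c, q b c ≤ ∑ c, q b c := fun b c =>
    Finset.single_le_sum (fun c _ => hq b c) (Finset.mem_univ c)
  have hcol : ∀ b c, q b c ≤ ∑ b, q b c := fun b c =>
    Finset.single_le_sum (fun b _ => hq b c) (Finset.mem_univ b)
  have htot : ∀ b c, q b c ≤ t := fun b c => (hrow b c).trans
    (Finset.single_le_sum (f := fun b => ∑ c, q b c)
      (fun b _ => Finset.sum_nonneg fun c _ => hq b c) (Finset.mem_univ b))
  have hsum := Finset.sum_le_sum fun b (_ : b ∈ Finset.univ) =>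
    Finset.sum_le_sum fun c (_ : c ∈ Finset.univ) =>
      mul_log_add_sub_le (hq b c) (hrow b c) (hcol b c) (htot b c)
  have hright : ∑ b, ∑ c, ((∑ c, q b c) * (∑ b, q b c) / t - q b c) = 0 := by
    simp only [Finset.sum_sub_distrib, ← Finset.sum_div, ← Finset.mul_sum, ← Finset.sum_mul]
    rw [Finset.sum_comm (f := fun c b => q b c), ← ht, mul_self_div_self, sub_self]
  rw [hright] at hsum
  simp only [mul_sub, mul_add, Finset.sum_sub_distrib, Finset.sum_add_distrib] at hsum
  rw [Finset.sum_comm (f := fun b c => q b c * Real.log (∑ b, q b c))] at hsum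
  simp only [← Finset.sum_mul, ← ht] at hsum
  linarith

/-- Nonnegativity of mutual information for an unnormalised nonnegative matrix, in bits. -/
theorem sum_mul_logb_marginals_le {B C : Type*} [Fintype B] [Fintype C] (q : B → C → ℝ)
    (hq : ∀ b c, 0 ≤ q b c) :
    ∑ b, (∑ c, q b c) * Real.logb 2 (∑ c, q b c) +
        ∑ c, (∑ b, q b c) * Real.logb 2 (∑ b, q b c) ≤
      ∑ b, ∑ c, q b c * Real.logb 2 (q b c) +
        (∑ b, ∑ c, q b c) * Real.logb 2 (∑ b, ∑ c, q b c) := by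
  simp only [Real.logb, ← mul_div_assoc, ← Finset.sum_div, ← add_div]
  exact div_le_div_of_nonneg_right (sum_mul_log_marginals_le q hq) (Real.log_pos one_lt_two).le

section EntropyInequalities

variable {I J K : Type*} [Fintype I] [Fintype J] [Fintype K] {P : I × J × K → ℝ}

theorem entropy_eq_sum (P : I × J × K → ℝ) :
    entropy P = -∑ i, ∑ j, ∑ k, P (i, j, k) * Real.logb 2 (P (i, j, k)) := by
  simp only [entropy, Fintype.sum_prod_type]

theorem IsProbDist.sum_eq_one (hP : IsProbDist P) : ∑ i, ∑ j, ∑ k, P (i, j, k) = 1 := by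
  simpa only [Fintype.sum_prod_type] using hP.2

theorem entropy_margIJ_le (hP : IsProbDist P) : entropy (margIJ P) ≤ entropy P := by
  rw [entropy_eq_sum]
  simp only [entropy, margIJ, Fintype.sum_prod_type]
  exact neg_le_neg <| Finset.sum_le_sum fun i _ => Finset.sum_le_sum fun j _ =>
    sum_mul_logb_le (fun k => P (i, j, k)) fun k => hP.1 _

theorem entropy_margIK_le (hP : IsProbDist P) : entropy (margIK P) ≤ entropy P := by
  rw [entropy_eq_sum]
  simp only [entropy, margIK, Fintype.sum_prod_type]
  refine neg_le_neg <| Finset.sum_le_sum fun i _ => ?_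
  rw [Finset.sum_comm]
  exact Finset.sum_le_sum fun k _ => sum_mul_logb_le (fun j => P (i, j, k)) fun j => hP.1 _

theorem entropy_margJK_le (hP : IsProbDist P) : entropy (margJK P) ≤ entropy P := by
  rw [entropy_eq_sum]
  simp only [entropy, margJK, Fintype.sum_prod_type]
  refine neg_le_neg ?_
  rw [Finset.sum_comm]
  refine Finset.sum_le_sum fun j _ => ?_
  rw [Finset.sum_comm]
  exact Finset.sum_le_sum fun k _ => sum_mul_logb_le (fun i => P (i, j, k)) fun i => hP.1 _

theorem entropy_add_margI_le (hP : IsProbDist P) :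
    entropy P + entropy (margI P) ≤ entropy (margIJ P) + entropy (margIK P) := by
  have h := Finset.sum_le_sum fun i (_ : i ∈ Finset.univ) =>
    sum_mul_logb_marginals_le (fun j k => P (i, j, k)) fun j k => hP.1 _
  rw [entropy_eq_sum]
  simp only [entropy, margI, margIJ, margIK, Fintype.sum_prod_type]
  simp only [Finset.sum_add_distrib] at h
  linarith

theorem entropy_add_margJ_le (hP : IsProbDist P) :
    entropy P + entropy (margJ P) ≤ entropy (margIJ P) + entropy (margJK P) := by
  have h := Finset.sum_le_sum fun j (_ : j ∈ Finset.univ) =>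
    sum_mul_logb_marginals_le (fun i k => P (i, j, k)) fun i k => hP.1 _
  rw [entropy_eq_sum]
  simp only [entropy, margJ, margIJ, margJK, Fintype.sum_prod_type]
  simp only [Finset.sum_add_distrib] at h
  rw [Finset.sum_comm (f := fun j i => (∑ k, P (i, j, k)) * Real.logb 2 (∑ k, P (i, j, k))),
    Finset.sum_comm (f := fun j i => ∑ k, P (i, j, k) * Real.logb 2 (P (i, j, k)))] at h
  linarith

theorem entropy_add_margK_le (hP : IsProbDist P) :
    entropy P + entropy (margK P) ≤ entropy (margIK P) + entropy (margJK P) := by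
  have h := Finset.sum_le_sum fun k (_ : k ∈ Finset.univ) =>
    sum_mul_logb_marginals_le (fun i j => P (i, j, k)) fun i j => hP.1 _
  have hcomm : ∑ k, ∑ i, ∑ j, P (i, j, k) * Real.logb 2 (P (i, j, k)) =
      ∑ i, ∑ j, ∑ k, P (i, j, k) * Real.logb 2 (P (i, j, k)) := by
    rw [Finset.sum_comm]
    exact Finset.sum_congr rfl fun i _ => Finset.sum_comm
  rw [entropy_eq_sum]
  simp only [entropy, margK, margIK, margJK, Fintype.sum_prod_type]
  simp only [Finset.sum_add_distrib] at h
  rw [hcomm,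
    Finset.sum_comm (f := fun k i => (∑ j, P (i, j, k)) * Real.logb 2 (∑ j, P (i, j, k))),
    Finset.sum_comm (f := fun k j => (∑ i, P (i, j, k)) * Real.logb 2 (∑ i, P (i, j, k)))] at h
  linarith

theorem entropy_margIJ_le_add (hP : IsProbDist P) :
    entropy (margIJ P) ≤ entropy (margI P) + entropy (margJ P) := by
  have h := sum_mul_logb_marginals_le (fun i j => ∑ k, P (i, j, k))
    fun i j => Finset.sum_nonneg fun k _ => hP.1 _
  rw [hP.sum_eq_one, Real.logb_one] at h
  simp only [entropy, margI, margJ, margIJ, Fintype.sum_prod_type]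
  linarith

theorem entropy_margIK_le_add (hP : IsProbDist P) :
    entropy (margIK P) ≤ entropy (margI P) + entropy (margK P) := by
  have h := sum_mul_logb_marginals_le (fun i k => ∑ j, P (i, j, k))
    fun i k => Finset.sum_nonneg fun j _ => hP.1 _
  have hcomm : ∀ i, ∑ k, ∑ j, P (i, j, k) = ∑ j, ∑ k, P (i, j, k) :=
    fun i => Finset.sum_comm
  simp only [hcomm] at h
  rw [hP.sum_eq_one, Real.logb_one] at h
  simp only [entropy, margI, margK, margIK, Fintype.sum_prod_type]
  linarith

theorem entropy_margJK_le_add (hP : IsProbDist P) :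
    entropy (margJK P) ≤ entropy (margJ P) + entropy (margK P) := by
  have h := sum_mul_logb_marginals_le (fun j k => ∑ i, P (i, j, k))
    fun j k => Finset.sum_nonneg fun i _ => hP.1 _
  have hcomm : ∀ j, ∑ k, ∑ i, P (i, j, k) = ∑ i, ∑ k, P (i, j, k) :=
    fun j => Finset.sum_comm
  have hcomm' : ∀ k, ∑ j, ∑ i, P (i, j, k) = ∑ i, ∑ j, P (i, j, k) :=
    fun k => Finset.sum_comm
  simp only [hcomm, hcomm'] at h
  rw [Finset.sum_comm (f := fun j i => ∑ k, P (i, j, k)), hP.sum_eq_one, Real.logb_one] at h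
  simp only [entropy, margJ, margK, margJK, Fintype.sum_prod_type]
  linarith

end EntropyInequalities

/-- If every nonnegative linear functional takes at some `v m` at least its value at `r`, then
`r` is dominated by a convex combination of the `v m`. -/
theorem exists_weights_dominating {ι : Type*} [Fintype ι] (v : ι → ℝ × ℝ × ℝ) (r : ℝ × ℝ × ℝ)
    (h : ∀ x y z : ℝ, 0 ≤ x → 0 ≤ y → 0 ≤ z →
      ∃ m, x * r.1 + y * r.2.1 + z * r.2.2 ≤ x * (v m).1 + y * (v m).2.1 + z * (v m).2.2) :
    ∃ w : ι → ℝ, (∀ m, 0 ≤ w m) ∧ (∑ m, w m) = 1 ∧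
      r.1 ≤ ∑ m, w m * (v m).1 ∧ r.2.1 ≤ ∑ m, w m * (v m).2.1 ∧
      r.2.2 ≤ ∑ m, w m * (v m).2.2 := by
  classical
  let L : (ι → ℝ) →ₗ[ℝ] ℝ × ℝ × ℝ := Fintype.linearCombination ℝ v
  by_cases hdisj : Disjoint (L '' stdSimplex ℝ ι) (Set.Ici r)
  · exfalso
    obtain ⟨f, s, t, hfs, hst, hft⟩ := geometric_hahn_banach_compact_closed
      ((convex_stdSimplex ℝ ι).linear_image L)
      ((isCompact_stdSimplex ℝ ι).image L.continuous_of_finiteDimensional)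
      (convex_Ici r) isClosed_Ici hdisj
    have hf : ∀ p : ℝ × ℝ × ℝ, f p = f (1, 0, 0) * p.1 + f (0, 1, 0) * p.2.1 +
        f (0, 0, 1) * p.2.2 := by
      intro p
      have hp : p = p.1 • (1, 0, 0) + p.2.1 • (0, 1, 0) + p.2.2 • (0, 0, 1) := by
        ext <;> simp
      conv_lhs => rw [hp]
      simp only [map_add, map_smul, smul_eq_mul]
      ring
    have hnonneg : ∀ e : ℝ × ℝ × ℝ, 0 ≤ e → 0 ≤ f e := by
      intro e he
      by_contra! hneg
      have hc : 0 ≤ (t - f r) / f e :=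
        div_nonneg_of_nonpos (sub_nonpos.2 (hft r Set.self_mem_Ici).le) hneg.le
      have := hft (r + ((t - f r) / f e) • e) (le_add_of_nonneg_right (smul_nonneg hc he))
      rw [map_add, map_smul, smul_eq_mul, div_mul_cancel₀ _ hneg.ne] at this
      linarith
    obtain ⟨m, hm⟩ := h (f (1, 0, 0)) (f (0, 1, 0)) (f (0, 0, 1))
      (hnonneg _ (by simp [Prod.le_def])) (hnonneg _ (by simp [Prod.le_def]))
      (hnonneg _ (by simp [Prod.le_def]))
    rw [← hf, ← hf] at hm
    have hvm := hfs (v m) ⟨Pi.single m 1, single_mem_stdSimplex ℝ m, by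
      simp [L, Fintype.linearCombination_apply_single]⟩
    have hr := hft r Set.self_mem_Ici
    linarith
  · obtain ⟨_, ⟨w, hw, rfl⟩, hr⟩ := Set.not_disjoint_iff.1 hdisj
    obtain ⟨hr1, hr2, hr3⟩ := hr
    simp only [L, Fintype.linearCombination_apply, Prod.fst_sum, Prod.snd_sum, Prod.smul_fst,
      Prod.smul_snd, smul_eq_mul] at hr1 hr2 hr3
    exact ⟨w, hw.1, hw.2, hr1, hr2, hr3⟩

theorem entropy_polytope_eq_convex_hull_description
    {I J K : Type*} [Fintype I] [Fintype J] [Fintype K]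
    (P : I × J × K → ℝ) (hP : IsProbDist P) :
    {r : ℝ × ℝ × ℝ | 0 ≤ r.1 ∧ 0 ≤ r.2.1 ∧ 0 ≤ r.2.2 ∧
      r.1 ≤ entropy (margI P) ∧
      r.2.1 ≤ entropy (margJ P) ∧
      r.2.2 ≤ entropy (margK P) ∧
      r.1 + r.2.1 ≤ entropy (margIJ P) ∧
      r.1 + r.2.2 ≤ entropy (margIK P) ∧
      r.2.1 + r.2.2 ≤ entropy (margJK P) ∧
      r.1 + r.2.1 + r.2.2 ≤ entropy P} =
    {r : ℝ × ℝ × ℝ | 0 ≤ r.1 ∧ 0 ≤ r.2.1 ∧ 0 ≤ r.2.2 ∧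
      ∃ w : Fin 6 → ℝ, (∀ m, 0 ≤ w m) ∧ (∑ m, w m) = 1 ∧
        r.1 ≤ ∑ m, w m * (entropyVertices P m).1 ∧
        r.2.1 ≤ ∑ m, w m * (entropyVertices P m).2.1 ∧
        r.2.2 ≤ ∑ m, w m * (entropyVertices P m).2.2} := by
  have mIJ := entropy_margIJ_le hP
  have mIK := entropy_margIK_le hP
  have mJK := entropy_margJK_le hP
  have sI := entropy_add_margI_le hP
  have sJ := entropy_add_margJ_le hP
  have sK := entropy_add_margK_le hP
  have aIJ := entropy_margIJ_le_add hP
  have aIK := entropy_margIK_le_add hP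
  have aJK := entropy_margJK_le_add hP
  ext ⟨a, b, c⟩
  simp only [Set.mem_ofPred_eq]
  refine and_congr_right fun ha => and_congr_right fun hb => and_congr_right fun hc => ⟨?_, ?_⟩
  · rintro ⟨hI, hJ, hK, hIJ, hIK, hJK, hIJK⟩
    refine exists_weights_dominating (entropyVertices P) (a, b, c) fun x y z hx hy hz => ?_
    rcases le_total x y with hxy | hxy <;> rcases le_total y z with hyz | hyz <;>
      rcases le_total x z with hxz | hxz
    · exact ⟨5, by simp [entropyVertices]; nlinarith⟩
    · exact ⟨5, by simp [entropyVertices]; nlinarith⟩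
    · exact ⟨3, by simp [entropyVertices]; nlinarith⟩
    · exact ⟨2, by simp [entropyVertices]; nlinarith⟩
    · exact ⟨4, by simp [entropyVertices]; nlinarith⟩
    · exact ⟨1, by simp [entropyVertices]; nlinarith⟩
    · exact ⟨0, by simp [entropyVertices]; nlinarith⟩
    · exact ⟨0, by simp [entropyVertices]; nlinarith⟩
  · rintro ⟨w, hw, hsum, h1, h2, h3⟩
    have bound : ∀ x y z s : ℝ, 0 ≤ x → 0 ≤ y → 0 ≤ z →
        (∀ m, x * (entropyVertices P m).1 + y * (entropyVertices P m).2.1 +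
          z * (entropyVertices P m).2.2 ≤ s) → x * a + y * b + z * c ≤ s := by
      intro x y z s hx hy hz hs
      calc x * a + y * b + z * c
          ≤ x * ∑ m, w m * (entropyVertices P m).1 + y * ∑ m, w m * (entropyVertices P m).2.1 +
            z * ∑ m, w m * (entropyVertices P m).2.2 := by gcongr
        _ = ∑ m, w m * (x * (entropyVertices P m).1 + y * (entropyVertices P m).2.1 +
            z * (entropyVertices P m).2.2) := by
          simp only [Finset.mul_sum, ← Finset.sum_add_distrib]
          exact Finset.sum_congr rfl fun m _ => by ring
        _ ≤ ∑ m, w m * s := Finset.sum_le_sum fun m _ => mul_le_mul_of_nonneg_left (hs m) (hw m)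
        _ = s := by rw [← Finset.sum_mul, hsum, one_mul]
    have hI := bound 1 0 0 (entropy (margI P)) (by simp) (by simp) (by simp)
      (fun m => by fin_cases m <;> simp [entropyVertices] <;> linarith)
    have hJ := bound 0 1 0 (entropy (margJ P)) (by simp) (by simp) (by simp)
      (fun m => by fin_cases m <;> simp [entropyVertices] <;> linarith)
    have hK := bound 0 0 1 (entropy (margK P)) (by simp) (by simp) (by simp)
      (fun m => by fin_cases m <;> simp [entropyVertices] <;> linarith)
    have hIJ := bound 1 1 0 (entropy (margIJ P)) (by simp) (by simp) (by simp)
      (fun m => by fin_cases m <;> simp [entropyVertices] <;> linarith)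
    have hIK := bound 1 0 1 (entropy (margIK P)) (by simp) (by simp) (by simp)
      (fun m => by fin_cases m <;> simp [entropyVertices] <;> linarith)
    have hJK := bound 0 1 1 (entropy (margJK P)) (by simp) (by simp) (by simp)
      (fun m => by fin_cases m <;> simp [entropyVertices] <;> linarith)
    have hIJK := bound 1 1 1 (entropy P) (by simp) (by simp) (by simp)
      (fun m => by fin_cases m <;> (simp [entropyVertices]; try linarith))
    refine ⟨?_, ?_, ?_, ?_, ?_, ?_, ?_⟩ <;> linarith
end
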